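/- Let n ≥ 1. (1) The set of pairs (u(Ω), v(Ω)) with Ω ∈ RTSeq_n and |Ω|_t = 0 is exactly {(u, u) : u ∈ S_n}. (2) The set of pairs (u(Ω), v(Ω)) with Ω ∈ RTSeq_n and |Ω|_t = n − 1 is exactly {(u, u·c_n) : u ∈ S_n, u(n) = n}. -/

import Mathlib

/-!
Statement 13.  Let `n ≥ 1`.
(1) The pairs `(u(Ω), v(Ω))` with `Ω ∈ RTSeq_n` and `|Ω|_t = 0` are exactly
`{(u, u) : u ∈ S_n}`.
(2) The pairs `(u(Ω), v(Ω))` with `Ω ∈ RTSeq_n` and `|Ω|_t = n − 1` are exactly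
`{(u, u·c_n) : u ∈ S_n, u(n) = n}`  (0-indexed: `u (n−1) = n−1`).
-/

/-- Permutations of the positive integers are modelled by `Equiv.Perm ℕ`, the positive
integer `p` corresponding to `p − 1 : ℕ`.  The insertion map `ins_i` (here `ins (i-1)`,
`0`-indexed) sends `j ↦ w(j) + 1` for `j < i`, `i ↦ 0`, and `j ↦ w(j−1) + 1` for `j > i`. -/
def ins (i : ℕ) (w : Equiv.Perm ℕ) : Equiv.Perm ℕ where
  toFun j := if j < i then w j + 1 else if j = i then 0 else w (j - 1) + 1
  invFun b := if b = 0 then i else if w.symm (b - 1) < i then w.symm (b - 1) else w.symm (b - 1) + 1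
  left_inv := by
    intro j
    dsimp only
    by_cases h1 : j < i
    · rw [if_pos h1, if_neg (by omega : ¬ (w j + 1 = 0)), Nat.add_sub_cancel,
        Equiv.symm_apply_apply, if_pos h1]
    · by_cases h2 : j = i
      · rw [if_neg h1, if_pos h2, if_pos rfl, h2]
      · rw [if_neg h1, if_neg h2, if_neg (by omega : ¬ (w (j - 1) + 1 = 0)),
          Nat.add_sub_cancel, Equiv.symm_apply_apply,
          if_neg (by omega : ¬ (j - 1 < i)), Nat.sub_add_cancel (by omega)]
  right_inv := by
    intro b
    dsimp only
    by_cases hb : b = 0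
    · rw [if_pos hb, if_neg (lt_irrefl i), if_pos rfl, hb]
    · rw [if_neg hb]
      by_cases hc : w.symm (b - 1) < i
      · rw [if_pos hc, if_pos hc, Equiv.apply_symm_apply, Nat.sub_add_cancel (by omega)]
      · rw [if_neg hc, if_neg (by omega : ¬ (w.symm (b - 1) + 1 < i)),
          if_neg (by omega : ¬ (w.symm (b - 1) + 1 = i)), Nat.add_sub_cancel,
          Equiv.apply_symm_apply, Nat.sub_add_cancel (by omega)]

/-- The number `ℓ(u)` of inversions of `u`. -/
noncomputable def invCount (u : Equiv.Perm ℕ) : ℕ :=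
  Set.ncard {p : ℕ × ℕ | p.1 < p.2 ∧ u p.2 < u p.1}

/-- The Bruhat order: `u ≤ v` iff there is a chain `u = w₀, …, w_m = v` where each
`w_{s+1} = w_s · τ_s` for a transposition `τ_s`, with `ℓ(w_{s+1}) > ℓ(w_s)`. -/
noncomputable def bruhatLE (u v : Equiv.Perm ℕ) : Prop :=
  ∃ (m : ℕ) (c : ℕ → Equiv.Perm ℕ), c 0 = u ∧ c m = v ∧
    ∀ s < m, (∃ a b : ℕ, a ≠ b ∧ c (s + 1) = c s * Equiv.swap a b) ∧
      invCount (c s) < invCount (c (s + 1))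

/-- `ℓ_a(u) = #{b ≥ a : u⁻¹(b) ≤ u⁻¹(a)}` (0-indexed: this is `ℓ_{a+1}` of the paper). -/
noncomputable def lA (a : ℕ) (u : Equiv.Perm ℕ) : ℕ :=
  Set.ncard {b : ℕ | a ≤ b ∧ u.symm b ≤ u.symm a}

/-- `u` fixes all but finitely many points, i.e. `u ∈ S_∞`. -/
def finitary (u : Equiv.Perm ℕ) : Prop := {a : ℕ | u a ≠ a}.Finite

/-- `u ∈ S_n`: `u` fixes every point `j > n` (0-indexed: every `j ≥ n`). -/
def inSn (n : ℕ) (u : Equiv.Perm ℕ) : Prop := ∀ j, n ≤ j → u j = j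

/-- The formal letters `r_j, t_j` (`j ≥ 1`); here `RTLetter.r k` stands for `r_{k+1}`
and `RTLetter.t k` for `t_{k+1}`. -/
inductive RTLetter : Type
  | r : ℕ → RTLetter
  | t : ℕ → RTLetter
deriving DecidableEq

/-- One step of the recursion defining `(u(Ω), v(Ω))`:
`r_j` maps `(u,v) ↦ (ins_j u, ins_j v)` and `t_j` maps `(u,v) ↦ (ins_j u, ins_{j+1} v)`. -/
def stepRT (p : Equiv.Perm ℕ × Equiv.Perm ℕ) : RTLetter → Equiv.Perm ℕ × Equiv.Perm ℕ
  | .r k => (ins k p.1, ins k p.2)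
  | .t k => (ins k p.1, ins (k + 1) p.2)

/-- The pair `(u(Ω), v(Ω))` attached to a sequence `Ω` (a list of letters, first letter
first):  `u(∅) = v(∅) = id`, and the last letter is applied outermost. -/
def uv (L : List RTLetter) : Equiv.Perm ℕ × Equiv.Perm ℕ := L.foldl stepRT (1, 1)

/-- The letter at (0-indexed) position `p` of a sequence in `RTSeq_n` must lie in
`{r₁, t₁, …, r_{p}, t_{p}, r_{p+1}}` (1-indexed position `s = p+1`). -/
def validLetter (p : ℕ) : RTLetter → Prop
  | .r k => k ≤ p
  | .t k => k + 1 ≤ p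

/-- `Ω ∈ RTSeq_n`: a sequence of `n` letters `X₁⋯X_n` with
`X_s ∈ {r₁, t₁, …, r_{s−1}, t_{s−1}, r_s}`. -/
def validSeq (n : ℕ) (L : List RTLetter) : Prop :=
  L.length = n ∧ ∀ p < L.length, validLetter p (L.getD p (.r 0))

/-- `|Ω|_t`, the number of letters of the form `t_j`. -/
def countT (L : List RTLetter) : ℕ :=
  L.countP (fun X => match X with | .t _ => true | .r _ => false)

/-- `c_n`, the backwards long cycle `n 1 2 ⋯ (n−1)` (0-indexed on `ℕ`:
`0 ↦ n−1`, `j ↦ j−1` for `1 ≤ j ≤ n−1`, `j ↦ j` for `j ≥ n`). -/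
def cB (n : ℕ) : Equiv.Perm ℕ where
  toFun j := if j = 0 then n - 1 else if j ≤ n - 1 then j - 1 else j
  invFun j := if j = n - 1 then 0 else if j < n - 1 then j + 1 else j
  left_inv := by
    intro j
    dsimp only
    split_ifs <;> (try exact absurd rfl ‹_›) <;> (try exact (‹False›).elim) <;> omega
  right_inv := by
    intro j
    dsimp only
    split_ifs <;> (try exact absurd rfl ‹_›) <;> (try exact (‹False›).elim) <;> omega

/-- `Ω′` is obtained from `Ω` by replacing the letters `t_i` at some subset of the
positions by either `r_i` or `r_{i+1}`. -/
def isReplacement (L L' : List RTLetter) : Prop :=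
  L'.length = L.length ∧
  ∀ p < L.length,
    L'.getD p (.r 0) = L.getD p (.r 0) ∨
    ∃ k, L.getD p (.r 0) = .t k ∧ (L'.getD p (.r 0) = .r k ∨ L'.getD p (.r 0) = .r (k + 1))


theorem ins_apply (i : ℕ) (w : Equiv.Perm ℕ) (j : ℕ) :
    ins i w j = if j < i then w j + 1 else if j = i then 0 else w (j - 1) + 1 := rfl

theorem cB_apply (n j : ℕ) :
    cB n j = if j = 0 then n - 1 else if j ≤ n - 1 then j - 1 else j := rfl

/-- Every permutation is obtained by inserting its value `0`. -/
theorem exists_ins_eq (u : Equiv.Perm ℕ) : ∃ w, ins (u.symm 0) w = u := by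
  obtain ⟨k, hk⟩ : ∃ k, u.symm 0 = k := ⟨_, rfl⟩
  have hk' : u k = 0 := by rw [← hk, Equiv.apply_symm_apply]
  have hne (j : ℕ) (hj : j ≠ k) : u j ≠ 0 := fun h => hj (u.injective (h.trans hk'.symm))
  have hsymm (b : ℕ) : u.symm (b + 1) ≠ k := fun h => by
    have := u.apply_symm_apply (b + 1)
    rw [h, hk'] at this
    omega
  refine ⟨⟨fun j => u (if j < k then j else j + 1) - 1,
    fun b => if u.symm (b + 1) < k then u.symm (b + 1) else u.symm (b + 1) - 1, ?_, ?_⟩, ?_⟩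
  · intro j
    dsimp only
    rw [Nat.sub_add_cancel (Nat.pos_of_ne_zero (hne _ (by split_ifs <;> omega))),
      Equiv.symm_apply_apply]
    split_ifs <;> omega
  · intro b
    have hb := hsymm b
    have harg : (if (if u.symm (b + 1) < k then u.symm (b + 1) else u.symm (b + 1) - 1) < k
        then (if u.symm (b + 1) < k then u.symm (b + 1) else u.symm (b + 1) - 1)
        else (if u.symm (b + 1) < k then u.symm (b + 1) else u.symm (b + 1) - 1) + 1) =
          u.symm (b + 1) := by
      split_ifs <;> omega
    dsimp only
    rw [harg, Equiv.apply_symm_apply, Nat.add_sub_cancel]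
  · ext j
    rw [hk, ins_apply, Equiv.coe_fn_mk]
    rcases lt_trichotomy j k with h | h | h
    · have := hne j h.ne
      rw [if_pos h, if_pos h]
      omega
    · rw [if_neg (by omega), if_pos h, h, hk']
    · have := hne j h.ne'
      rw [if_neg (by omega), if_neg (by omega), if_neg (by omega), Nat.sub_add_cancel (by omega : 1 ≤ j)]
      omega

theorem inSn_succ_ins {n k : ℕ} (hk : k ≤ n) (w : Equiv.Perm ℕ) :
    inSn (n + 1) (ins k w) ↔ inSn n w := by
  have key (j : ℕ) (hj : n ≤ j) : ins k w (j + 1) = w j + 1 := by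
    rw [ins_apply, if_neg (by omega), if_neg (by omega), Nat.add_sub_cancel]
  refine ⟨fun h j hj => ?_, fun h j hj => ?_⟩
  · have := h (j + 1) (by omega)
    rw [key j hj] at this
    omega
  · obtain ⟨i, rfl⟩ : ∃ i, j = i + 1 := ⟨j - 1, by omega⟩
    rw [key i (by omega), h i (by omega)]

theorem inSn_succ_iff_exists_ins (n : ℕ) (u : Equiv.Perm ℕ) :
    inSn (n + 1) u ↔ ∃ k ≤ n, ∃ w, inSn n w ∧ u = ins k w := by
  constructor
  · intro h
    have hk : u.symm 0 ≤ n := by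
      by_contra! hlt
      have := h _ hlt
      rw [Equiv.apply_symm_apply] at this
      omega
    obtain ⟨w, hw⟩ := exists_ins_eq u
    exact ⟨_, hk, w, (inSn_succ_ins hk w).1 (hw.symm ▸ h), hw.symm⟩
  · rintro ⟨k, hk, w, hw, rfl⟩
    exact (inSn_succ_ins hk w).2 hw

theorem inSn_zero {u : Equiv.Perm ℕ} : inSn 0 u ↔ u = 1 :=
  ⟨fun h => Equiv.ext fun j => h j (Nat.zero_le j), fun h _ _ => by rw [h, Equiv.Perm.one_apply]⟩

theorem inSn_succ_and_apply_self (n : ℕ) (u : Equiv.Perm ℕ) :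
    inSn (n + 1) u ∧ u n = n ↔ inSn n u := by
  refine ⟨fun h j hj => ?_, fun h => ⟨fun j hj => h j (by omega), h n le_rfl⟩⟩
  obtain rfl | hlt := hj.eq_or_lt
  exacts [h.2, h.1 j hlt]

theorem ins_succ_mul_cB {n k : ℕ} (hk : k ≤ n) (u : Equiv.Perm ℕ) :
    ins (k + 1) (u * cB (n + 1)) = ins k u * cB (n + 2) := by
  ext j
  rw [Equiv.Perm.mul_apply, ins_apply, ins_apply, Equiv.Perm.mul_apply, Equiv.Perm.mul_apply,
    cB_apply, cB_apply, cB_apply]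
  split_ifs <;> first | omega | congr 2

theorem cB_one : cB 1 = 1 := by
  ext j
  rw [cB_apply, Equiv.Perm.one_apply]
  split_ifs <;> omega

theorem validSeq_concat (n : ℕ) (L : List RTLetter) (X : RTLetter) :
    validSeq (n + 1) (L ++ [X]) ↔ validSeq n L ∧ validLetter n X := by
  unfold validSeq
  simp only [List.length_append, List.length_singleton, Nat.add_right_cancel_iff, and_assoc]
  refine and_congr_right fun hL => ?_
  subst hL
  constructor
  · intro h
    refine ⟨fun p hp => ?_, ?_⟩
    · rw [← List.getD_append L [X] (.r 0) p hp]
      exact h p (by omega)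
    · simpa using h L.length (by omega)
  · rintro ⟨h, hX⟩ p hp
    obtain hlt | rfl : p < L.length ∨ p = L.length := by omega
    · rw [List.getD_append L [X] (.r 0) p hlt]
      exact h p hlt
    · simpa using hX

theorem exists_validSeq_succ (n : ℕ) (P : List RTLetter → Prop) :
    (∃ L, validSeq (n + 1) L ∧ P L) ↔
      ∃ L X, validSeq n L ∧ validLetter n X ∧ P (L ++ [X]) := by
  constructor
  · rintro ⟨L, hL, hP⟩
    obtain rfl | ⟨L, X, rfl⟩ := L.eq_nil_or_concat'
    · exact absurd hL.1 (by simp)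
    · exact ⟨L, X, ((validSeq_concat n L X).1 hL).1, ((validSeq_concat n L X).1 hL).2, hP⟩
  · rintro ⟨L, X, hL, hX, hP⟩
    exact ⟨_, (validSeq_concat n L X).2 ⟨hL, hX⟩, hP⟩

theorem uv_concat (L : List RTLetter) (X : RTLetter) : uv (L ++ [X]) = stepRT (uv L) X := by
  simp [uv]

theorem countT_concat_r (L : List RTLetter) (k : ℕ) : countT (L ++ [.r k]) = countT L := by
  simp [countT]

theorem countT_concat_t (L : List RTLetter) (k : ℕ) : countT (L ++ [.t k]) = countT L + 1 := by
  simp [countT]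

theorem validSeq_zero {L : List RTLetter} : validSeq 0 L ↔ L = [] :=
  ⟨fun h => List.length_eq_zero_iff.1 h.1, fun h => by subst h; exact ⟨rfl, by simp⟩⟩

theorem countT_le_of_validSeq (n : ℕ) (L : List RTLetter) (hL : validSeq (n + 1) L) :
    countT L ≤ n := by
  induction n generalizing L with
  | zero =>
    obtain rfl | ⟨L, X, rfl⟩ := L.eq_nil_or_concat'
    · exact absurd hL.1 (by simp)
    obtain ⟨hL, hX⟩ := (validSeq_concat _ L X).1 hL
    obtain rfl := validSeq_zero.1 hL
    cases X with
    | r k => simp [countT]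
    | t k => exact absurd hX (Nat.not_succ_le_zero k)
  | succ n ih =>
    obtain rfl | ⟨L, X, rfl⟩ := L.eq_nil_or_concat'
    · exact absurd hL.1 (by simp)
    have := ih L ((validSeq_concat _ L X).1 hL).1
    cases X with
    | r k => rw [countT_concat_r]; omega
    | t k => rw [countT_concat_t]; omega

theorem exists_validSeq_countT_zero (n : ℕ) (p : Equiv.Perm ℕ × Equiv.Perm ℕ) :
    (∃ L, validSeq n L ∧ countT L = 0 ∧ p = uv L) ↔ ∃ u, inSn n u ∧ p = (u, u) := by
  induction n generalizing p with
  | zero => simp [validSeq_zero, inSn_zero, countT, uv]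
  | succ n ih =>
    rw [exists_validSeq_succ]
    constructor
    · rintro ⟨L, X, hL, hX, hc, rfl⟩
      cases X with
      | t k => rw [countT_concat_t] at hc; omega
      | r k =>
        rw [countT_concat_r] at hc
        obtain ⟨u, hu, huv⟩ := (ih (uv L)).1 ⟨L, hL, hc, rfl⟩
        exact ⟨ins k u, (inSn_succ_ins hX u).2 hu, by rw [uv_concat, huv]; rfl⟩
    · rintro ⟨u, hu, rfl⟩
      obtain ⟨k, hk, w, hw, rfl⟩ := (inSn_succ_iff_exists_ins n u).1 hu
      obtain ⟨L, hL, hc, huv⟩ := (ih (w, w)).2 ⟨w, hw, rfl⟩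
      exact ⟨L, .r k, hL, hk, by rw [countT_concat_r, hc], by rw [uv_concat, ← huv]; rfl⟩

theorem exists_validSeq_succ_countT_eq (n : ℕ) (p : Equiv.Perm ℕ × Equiv.Perm ℕ) :
    (∃ L, validSeq (n + 1) L ∧ countT L = n ∧ p = uv L) ↔
      ∃ u, inSn n u ∧ p = (u, u * cB (n + 1)) := by
  induction n generalizing p with
  | zero =>
    rw [exists_validSeq_countT_zero]
    simp only [← inSn_succ_and_apply_self 0, zero_add, cB_one, mul_one]
    refine exists_congr fun u => and_congr_left fun _ => (and_iff_left_of_imp fun h => ?_).symm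
    obtain ⟨k, hk, w, -, rfl⟩ := (inSn_succ_iff_exists_ins 0 u).1 h
    rw [ins_apply, if_neg (by omega), if_pos (by omega)]
  | succ n ih =>
    rw [exists_validSeq_succ]
    constructor
    · rintro ⟨L, X, hL, hX, hc, rfl⟩
      cases X with
      | r k =>
        have := countT_le_of_validSeq n L hL
        rw [countT_concat_r] at hc
        omega
      | t k =>
        rw [countT_concat_t, Nat.add_right_cancel_iff] at hc
        obtain ⟨u, hu, huv⟩ := (ih (uv L)).1 ⟨L, hL, hc, rfl⟩
        have hk : k ≤ n := Nat.le_of_succ_le_succ hX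
        refine ⟨ins k u, (inSn_succ_ins hk u).2 hu, ?_⟩
        rw [uv_concat, huv, ← ins_succ_mul_cB hk]
        rfl
    · rintro ⟨u, hu, rfl⟩
      obtain ⟨k, hk, w, hw, rfl⟩ := (inSn_succ_iff_exists_ins n u).1 hu
      obtain ⟨L, hL, hc, huv⟩ := (ih (w, w * cB (n + 1))).2 ⟨w, hw, rfl⟩
      refine ⟨L, .t k, hL, Nat.succ_le_succ hk, by rw [countT_concat_t, hc], ?_⟩
      rw [uv_concat, ← huv, ← ins_succ_mul_cB hk]
      rfl

theorem stmt13 (n : ℕ) (hn : 1 ≤ n) :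
    ({p : Equiv.Perm ℕ × Equiv.Perm ℕ | ∃ L, validSeq n L ∧ countT L = 0 ∧ p = uv L} =
      {p : Equiv.Perm ℕ × Equiv.Perm ℕ | ∃ u, inSn n u ∧ p = (u, u)}) ∧
    ({p : Equiv.Perm ℕ × Equiv.Perm ℕ | ∃ L, validSeq n L ∧ countT L = n - 1 ∧ p = uv L} =
      {p : Equiv.Perm ℕ × Equiv.Perm ℕ |
        ∃ u, inSn n u ∧ u (n - 1) = n - 1 ∧ p = (u, u * cB n)}) := by
  refine ⟨Set.ext fun p => exists_validSeq_countT_zero n p, Set.ext fun p => ?_⟩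
  obtain ⟨m, rfl⟩ : ∃ m, n = m + 1 := ⟨n - 1, by omega⟩
  simp only [Set.mem_ofPred_eq, Nat.add_sub_cancel, ← and_assoc, inSn_succ_and_apply_self]
  simpa only [and_assoc] using exists_validSeq_succ_countT_eq m p
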